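/- Let 𝕂 = ℝ or 𝕂 = ℂ, and let M be a compact Hausdorff space such that C(M;ℂ) is isometrically isomorphic as a complex Banach algebra to L^∞(𝕋). Then the Banach space C(M ⊕ OnePoint ℕ; 𝕂) of continuous 𝕂-valued functions on the topological sum of M and the one-point compactification of ℕ admits an isometric shift. -/

import Mathlib

open Topology

/-- `T` is an isometric shift: an isometry whose range has codimension 1 and with
`⋂_{n≥1} Tⁿ(E) = {0}`. -/
def IsIsometricShift {𝕜 E : Type*} [RCLike 𝕜] [NormedAddCommGroup E] [NormedSpace 𝕜 E]
    (T : E →L[𝕜] E) : Prop :=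
  (∀ f, ‖T f‖ = ‖f‖) ∧
    Module.rank 𝕜 (E ⧸ LinearMap.range (T : E →ₗ[𝕜] E)) = 1 ∧
    (⋂ n : ℕ, Set.range ((⇑T)^[n + 1])) = {0}

open MeasureTheory in
instance : Fact (0 < 2 * Real.pi) := ⟨by positivity⟩

open MeasureTheory in
/-- `C(M, ℂ)` is isometrically isomorphic, as a complex Banach algebra, to `L^∞(𝕋)`
(realized as `Lp ℂ ∞` of the circle `ℝ/2πℤ` with Lebesgue/Haar measure): there is a
complex-linear isometric equivalence which is moreover multiplicative (hence a Banach
algebra isomorphism). -/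
def IsCMIsoLinftyCircle (M : Type*) [TopologicalSpace M] [CompactSpace M] : Prop :=
  ∃ e : C(M, ℂ) ≃ₗᵢ[ℂ] Lp ℂ ⊤ (volume : Measure (AddCircle (2 * Real.pi))),
    ∀ f g : C(M, ℂ),
      ((e (f * g) : AddCircle (2 * Real.pi) →ₘ[volume] ℂ)) = ↑(e f) * ↑(e g)

open Filter in
/-- The convergent sequence `c, f 0, f 1, …`, with the same limit as `f`. -/
noncomputable def consNat {Y : Type*} [TopologicalSpace Y] (c : Y) (f : C(OnePoint ℕ, Y)) :
    C(OnePoint ℕ, Y) :=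
  OnePoint.continuousMapMkNat (fun n => Nat.casesOn n c fun k => f (k : OnePoint ℕ))
    (f OnePoint.infty)
    ((tendsto_add_atTop_iff_nat 1).1 ((OnePoint.continuous_iff_from_nat f).1 f.continuous))

section Shift

variable {𝕂 M : Type*} [RCLike 𝕂] [TopologicalSpace M]

/-- The restriction of a function on `M ⊕ N` to `M`. -/
def restrictInl {N : Type*} [TopologicalSpace N] (f : C(M ⊕ N, 𝕂)) : C(M, 𝕂) :=
  f.comp ⟨Sum.inl, continuous_inl⟩

/-- The restriction of a function on `M ⊕ N` to `N`. -/
def restrictInr {N : Type*} [TopologicalSpace N] (f : C(M ⊕ N, 𝕂)) : C(N, 𝕂) :=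
  f.comp ⟨Sum.inr, continuous_inr⟩

/-- The operator sending a pair (function `g` on `M`, convergent sequence `c`) to the pair
`(R g, (Λ g, c 0, c 1, …))`. -/
noncomputable def shiftFun (R : C(M, 𝕂) → C(M, 𝕂)) (Λ : C(M, 𝕂) → 𝕂)
    (f : C(M ⊕ OnePoint ℕ, 𝕂)) : C(M ⊕ OnePoint ℕ, 𝕂) where
  toFun := Sum.elim (R (restrictInl f)) (consNat (Λ (restrictInl f)) (restrictInr f))
  continuous_toFun := by fun_prop

lemma restrictInl_shiftFun (R : C(M, 𝕂) → C(M, 𝕂)) (Λ : C(M, 𝕂) → 𝕂)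
    (f : C(M ⊕ OnePoint ℕ, 𝕂)) : restrictInl (shiftFun R Λ f) = R (restrictInl f) := rfl

lemma ext_sum_onePoint {f g : C(M ⊕ OnePoint ℕ, 𝕂)} (hl : restrictInl f = restrictInl g)
    (hr : ∀ k : ℕ, f (Sum.inr (k : OnePoint ℕ)) = g (Sum.inr (k : OnePoint ℕ)))
    (hi : f (Sum.inr OnePoint.infty) = g (Sum.inr OnePoint.infty)) : f = g := by
  ext (x | x)
  · exact DFunLike.congr_fun hl x
  · induction x using OnePoint.rec with
    | infty => exact hi
    | coe k => exact hr k

variable [CompactSpace M]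

lemma norm_restrictInl_le (f : C(M ⊕ OnePoint ℕ, 𝕂)) : ‖restrictInl f‖ ≤ ‖f‖ :=
  (ContinuousMap.norm_le _ (norm_nonneg _)).2 fun x => f.norm_coe_le_norm (Sum.inl x)

lemma norm_shiftFun (R : C(M, 𝕂) →ₗᵢ[𝕂] C(M, 𝕂)) (Λ : C(M, 𝕂) → 𝕂) (hΛ : ∀ g, ‖Λ g‖ ≤ ‖g‖)
    (f : C(M ⊕ OnePoint ℕ, 𝕂)) : ‖shiftFun R Λ f‖ = ‖f‖ := by
  apply le_antisymm
  · refine (ContinuousMap.norm_le _ (norm_nonneg _)).2 ?_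
    rintro (x | x)
    · exact ((R _).norm_coe_le_norm x).trans (by simpa using norm_restrictInl_le f)
    · induction x using OnePoint.rec with
      | infty => exact f.norm_coe_le_norm _
      | coe k =>
        cases k with
        | zero => exact (hΛ _).trans (norm_restrictInl_le f)
        | succ k => exact f.norm_coe_le_norm _
  · refine (ContinuousMap.norm_le _ (norm_nonneg _)).2 ?_
    rintro (x | x)
    · calc ‖f (Sum.inl x)‖ ≤ ‖restrictInl f‖ := (restrictInl f).norm_coe_le_norm x
        _ = ‖restrictInl (shiftFun R Λ f)‖ := by rw [restrictInl_shiftFun, R.norm_map]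
        _ ≤ _ := norm_restrictInl_le _
    · induction x using OnePoint.rec with
      | infty => exact (shiftFun R Λ f).norm_coe_le_norm (Sum.inr OnePoint.infty)
      | coe k =>
        exact (shiftFun R Λ f).norm_coe_le_norm (Sum.inr ((k + 1 : ℕ) : OnePoint ℕ))

/-- `shiftFun` as a linear isometry. -/
noncomputable def shiftLI (R : C(M, 𝕂) →ₗᵢ[𝕂] C(M, 𝕂)) (Λ : C(M, 𝕂) →ₗ[𝕂] 𝕂)
    (hΛ : ∀ g, ‖Λ g‖ ≤ ‖g‖) : C(M ⊕ OnePoint ℕ, 𝕂) →ₗᵢ[𝕂] C(M ⊕ OnePoint ℕ, 𝕂) where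
  toFun := shiftFun R Λ
  map_add' f g := by
    have h : restrictInl (f + g) = restrictInl f + restrictInl g := rfl
    refine ext_sum_onePoint ?_ ?_ ?_
    · change R (restrictInl (f + g)) = R (restrictInl f) + R (restrictInl g)
      rw [h, map_add]
    · rintro (_ | k)
      · change Λ (restrictInl (f + g)) = Λ (restrictInl f) + Λ (restrictInl g)
        rw [h, map_add]
      · rfl
    · rfl
  map_smul' a f := by
    have h : restrictInl (a • f) = a • restrictInl f := rfl
    refine ext_sum_onePoint ?_ ?_ ?_
    · change R (restrictInl (a • f)) = a • R (restrictInl f)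
      rw [h, map_smul]
    · rintro (_ | k)
      · change Λ (restrictInl (a • f)) = a • Λ (restrictInl f)
        rw [h, map_smul]
      · rfl
    · rfl
  norm_map' := norm_shiftFun R Λ hΛ

/-- The functional whose kernel is the range of `shiftFun R Λ`. -/
noncomputable def shiftDefect (R : C(M, 𝕂) ≃ₗᵢ[𝕂] C(M, 𝕂)) (Λ : C(M, 𝕂) →ₗ[𝕂] 𝕂) :
    C(M ⊕ OnePoint ℕ, 𝕂) →ₗ[𝕂] 𝕂 where
  toFun f := f (Sum.inr ((0 : ℕ) : OnePoint ℕ)) - Λ (R.symm (restrictInl f))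
  map_add' f g := by
    have h : restrictInl (f + g) = restrictInl f + restrictInl g := rfl
    simp only [h, map_add, ContinuousMap.add_apply]
    ring
  map_smul' a f := by
    have h : restrictInl (a • f) = a • restrictInl f := rfl
    simp only [h, map_smul, ContinuousMap.smul_apply, smul_eq_mul, RingHom.id_apply]
    ring

open Filter

lemma ker_shiftDefect (R : C(M, 𝕂) ≃ₗᵢ[𝕂] C(M, 𝕂)) (Λ : C(M, 𝕂) →ₗ[𝕂] 𝕂)
    (hΛ : ∀ g, ‖Λ g‖ ≤ ‖g‖) :
    LinearMap.ker (shiftDefect R Λ) =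
      LinearMap.range (shiftLI R.toLinearIsometry Λ hΛ).toLinearMap := by
  ext f
  rw [LinearMap.mem_ker, LinearMap.mem_range]
  constructor
  · intro hf
    have hf : f (Sum.inr ((0 : ℕ) : OnePoint ℕ)) = Λ (R.symm (restrictInl f)) := sub_eq_zero.1 hf
    let c : C(OnePoint ℕ, 𝕂) := OnePoint.continuousMapMkNat
      (fun n => f (Sum.inr ((n + 1 : ℕ) : OnePoint ℕ))) (f (Sum.inr OnePoint.infty))
      ((tendsto_add_atTop_iff_nat 1).2
        ((OnePoint.continuous_iff_from_nat (restrictInr f)).1 (restrictInr f).continuous))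
    let g : C(M ⊕ OnePoint ℕ, 𝕂) :=
      ⟨Sum.elim (R.symm (restrictInl f)) c, by fun_prop⟩
    have hg : restrictInl g = R.symm (restrictInl f) := rfl
    refine ⟨g, ext_sum_onePoint ?_ ?_ rfl⟩
    · change R (restrictInl g) = _
      rw [hg, R.apply_symm_apply]
    · rintro (_ | k)
      · change Λ (restrictInl g) = _
        rw [hg, hf]
      · rfl
  · rintro ⟨g, rfl⟩
    change Λ (restrictInl g) - Λ (R.symm (R (restrictInl g))) = 0
    rw [R.symm_apply_apply, sub_self]

lemma shiftDefect_surjective (R : C(M, 𝕂) ≃ₗᵢ[𝕂] C(M, 𝕂)) (Λ : C(M, 𝕂) →ₗ[𝕂] 𝕂) :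
    Function.Surjective (shiftDefect R Λ) := by
  intro a
  let g : C(M ⊕ OnePoint ℕ, 𝕂) :=
    ⟨Sum.elim (0 : C(M, 𝕂)) (ContinuousMap.const (OnePoint ℕ) a), by fun_prop⟩
  have hg : restrictInl g = 0 := rfl
  refine ⟨g, ?_⟩
  change a - Λ (R.symm (restrictInl g)) = a
  rw [hg, map_zero, map_zero, sub_zero]

/-- A surjective isometry `R` of `C(M, 𝕂)` and a contractive functional `Λ` produce an isometric
shift on `C(M ⊕ OnePoint ℕ, 𝕂)` as soon as no nonzero backward `R`-orbit is mapped by `Λ` to a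
convergent sequence. -/
theorem exists_isIsometricShift (R : C(M, 𝕂) ≃ₗᵢ[𝕂] C(M, 𝕂)) (Λ : C(M, 𝕂) →ₗ[𝕂] 𝕂)
    (hΛ : ∀ g, ‖Λ g‖ ≤ ‖g‖)
    (horbit : ∀ g : ℕ → C(M, 𝕂), (∀ n, R (g (n + 1)) = g n) →
      ∀ l, Tendsto (fun n => Λ (g n)) atTop (𝓝 l) → g 0 = 0) :
    ∃ T : C(M ⊕ OnePoint ℕ, 𝕂) →L[𝕂] C(M ⊕ OnePoint ℕ, 𝕂), IsIsometricShift T := by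
  set T := shiftLI R.toLinearIsometry Λ hΛ with hT
  refine ⟨T.toContinuousLinearMap, T.norm_map, ?_, ?_⟩
  · have e := (Submodule.quotEquivOfEq _ _ (ker_shiftDefect R Λ hΛ)).symm.trans
      ((shiftDefect R Λ).quotKerEquivOfSurjective (shiftDefect_surjective R Λ))
    have := e.lift_rank_eq
    rwa [CommSemiring.rank_self, Cardinal.lift_one, Cardinal.lift_eq_one] at this
  · refine Set.eq_singleton_iff_unique_mem.2 ⟨?_, ?_⟩
    · refine Set.mem_iInter.2 fun n => ⟨0, ?_⟩
      exact Function.iterate_fixed (map_zero T) _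
    · intro f hf
      have hf' : ∀ n, ∃ g, T^[n] g = f := by
        rintro (_ | n)
        · exact ⟨f, rfl⟩
        · exact Set.mem_iInter.1 hf n
      choose F hF using hf'
      have hF0 : F 0 = f := hF 0
      have hstep : ∀ n, T (F (n + 1)) = F n := fun n =>
        T.injective.iterate n (by rw [hF, ← Function.iterate_succ_apply, hF])
      have hR : ∀ n, R (restrictInl (F (n + 1))) = restrictInl (F n) := fun n => by
        conv_rhs => rw [← hstep n]
        rfl
      have hval : ∀ n m : ℕ, F m (Sum.inr (n : OnePoint ℕ)) = Λ (restrictInl (F (m + n + 1))) := by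
        intro n
        induction n with
        | zero => intro m; rw [← hstep m]; rfl
        | succ n ih =>
          intro m
          rw [← hstep m, show m + (n + 1) + 1 = (m + 1) + n + 1 by ring, ← ih]; rfl
      have hlim : Tendsto (fun n : ℕ => F 0 (Sum.inr (n : OnePoint ℕ))) atTop
          (𝓝 (F 0 (Sum.inr OnePoint.infty))) :=
        (OnePoint.continuous_iff_from_nat (restrictInr (F 0))).1 (restrictInr (F 0)).continuous
      have hzero : restrictInl (F 0) = 0 := by
        refine horbit (fun n => restrictInl (F n)) hR (F 0 (Sum.inr OnePoint.infty)) ?_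
        refine (tendsto_add_atTop_iff_nat 1).1 (hlim.congr fun n => ?_)
        rw [hval, zero_add]
      have hall : ∀ n, restrictInl (F n) = 0 := by
        intro n
        induction n with
        | zero => exact hzero
        | succ n ih => exact R.injective (by rw [hR, ih, map_zero])
      have hnat : ∀ n : ℕ, F 0 (Sum.inr (n : OnePoint ℕ)) = 0 := fun n => by
        rw [hval, hall, map_zero]
      rw [← hF0]
      refine ext_sum_onePoint hzero hnat ?_
      exact tendsto_nhds_unique hlim (by simp [hnat])

end Shift

section Composition

variable {M : Type*} [TopologicalSpace M] [CompactSpace M] [T2Space M]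

/-- Every endomorphism of the algebra `C(M, ℂ)` is composition with a continuous map. -/
theorem exists_comp_of_algHom (Ψ : C(M, ℂ) →ₐ[ℂ] C(M, ℂ)) :
    ∃ φ : C(M, M), ∀ f, Ψ f = f.comp φ := by
  have hchar : ∀ x : M, ∃ y : M, ∀ f : C(M, ℂ), Ψ f x = f y := by
    intro x
    let χ : WeakDual.characterSpace ℂ C(M, ℂ) := WeakDual.CharacterSpace.equivAlgHom.symm
      ((ContinuousMap.evalAlgHom ℂ ℂ x).comp Ψ)
    obtain ⟨y, hy⟩ := (WeakDual.CharacterSpace.continuousMapEval_bijective M ℂ).2 χ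
    exact ⟨y, fun f => (DFunLike.congr_fun hy f).symm⟩
  choose φ hφ using hchar
  have hcont : Continuous φ := by
    rw [← (WeakDual.CharacterSpace.homeoEval M ℂ).comp_continuous_iff]
    refine continuous_induced_rng.2 (WeakDual.continuous_of_continuous_eval fun f => ?_)
    exact (Ψ f).continuous.congr fun x => hφ x f
  exact ⟨⟨φ, hcont⟩, fun f => ContinuousMap.ext fun x => hφ x f⟩

/-- Continuous complex-valued functions separate the points of a compact Hausdorff space. -/
lemma eq_of_forall_apply_eq {x y : M} (h : ∀ f : C(M, ℂ), f x = f y) : x = y := by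
  apply (WeakDual.CharacterSpace.continuousMapEval_bijective M ℂ).1
  ext f
  exact h f

/-- Mutually inverse endomorphisms of `C(M, ℂ)` come from a homeomorphism of `M`. -/
theorem exists_homeomorph_of_algHom (Ψ Θ : C(M, ℂ) →ₐ[ℂ] C(M, ℂ)) (hΨΘ : ∀ f, Ψ (Θ f) = f)
    (hΘΨ : ∀ f, Θ (Ψ f) = f) : ∃ φ : M ≃ₜ M, ∀ f, Ψ f = f.comp (φ : C(M, M)) := by
  obtain ⟨φ, hφ⟩ := exists_comp_of_algHom Ψ
  obtain ⟨θ, hθ⟩ := exists_comp_of_algHom Θ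
  refine ⟨⟨⟨φ, θ, fun x => ?_, fun x => ?_⟩, φ.continuous, θ.continuous⟩, hφ⟩
  · refine eq_of_forall_apply_eq fun f => ?_
    have := DFunLike.congr_fun (hΨΘ f) x
    rwa [hφ, hθ] at this
  · refine eq_of_forall_apply_eq fun f => ?_
    have := DFunLike.congr_fun (hΘΨ f) x
    rwa [hθ, hφ] at this

end Composition

section Density

open Filter

/-- If `(-1) ^ n * H (n • β)` converges, where `H` is continuous and the multiples of `2 • β` are
dense, then `H` vanishes. -/
lemma eq_zero_of_tendsto_alternating {G : Type*} [AddCommGroup G] [TopologicalSpace G]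
    [CompactSpace G] [IsTopologicalAddGroup G] {H : G → ℝ} (hH : Continuous H) {β : G}
    (hβ : DenseRange fun n : ℤ => n • (2 • β)) {l : ℝ}
    (hl : Tendsto (fun n : ℕ => (-1) ^ n * H (n • β)) atTop (𝓝 l)) (y : G) : H y = 0 := by
  have key : ∀ (K : G → ℝ) (c : ℝ), Continuous K →
      Tendsto (fun n : ℕ => K (n • (2 • β))) atTop (𝓝 c) → ∀ m : ℤ, K (m • (2 • β)) = c := by
    intro K c hK hc m
    have hcl := (mapClusterPt_self_zsmul_atTop_nsmul (2 • β) m).continuousAt_comp hK.continuousAt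
    exact eq_of_nhds_neBot (NeBot.mono hcl (inf_le_inf_left _ hc))
  have heven : ∀ m : ℤ, H (m • (2 • β)) = l := by
    refine key H l hH ?_
    have h2 : Tendsto (fun n : ℕ => n * 2) atTop atTop :=
      tendsto_atTop_mono (fun n => by simp only [id]; omega) tendsto_id
    refine (hl.comp h2).congr fun n => ?_
    rw [Function.comp_apply, mul_nsmul', pow_mul', neg_one_sq, one_pow, one_mul]
  have hodd : ∀ m : ℤ, H (m • (2 • β) + β) = -l := by
    refine key (fun y => H (y + β)) (-l) (by fun_prop) ?_
    have h2 : Tendsto (fun n : ℕ => n * 2 + 1) atTop atTop :=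
      tendsto_atTop_mono (fun n => by simp only [id]; omega) tendsto_id
    refine (hl.comp h2).neg.congr fun n => ?_
    rw [Function.comp_apply, add_nsmul, mul_nsmul', one_nsmul, pow_succ, pow_mul', neg_one_sq,
      one_pow, one_mul, neg_one_mul, neg_neg]
  have hconst : ∀ y, H y = l := fun y => congrFun
    (hβ.equalizer hH continuous_const (funext heven)) y
  have h0 := hodd 0
  rw [hconst] at h0
  rw [hconst]
  linarith

lemma exists_denseRange_zsmul_two_nsmul :
    ∃ β : AddCircle (2 * Real.pi), DenseRange fun n : ℤ => n • (2 • β) := by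
  refine ⟨((√2 / 2 * (2 * Real.pi) : ℝ) : AddCircle (2 * Real.pi)), ?_⟩
  have h : (2 • ((√2 / 2 * (2 * Real.pi) : ℝ) : AddCircle (2 * Real.pi))) =
      ((√2 * (2 * Real.pi) : ℝ) : AddCircle (2 * Real.pi)) := by
    rw [← AddCircle.coe_nsmul]
    congr 1
    rw [nsmul_eq_mul]
    push_cast
    ring
  rw [h]
  refine AddCircle.denseRange_zsmul_coe_iff.2 ?_
  rw [mul_div_cancel_right₀ _ (by positivity)]
  exact irrational_sqrt_two

end Density

section FourierCoefficients

open MeasureTheory AddCircle Filter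
open scoped ComplexConjugate

variable {T : ℝ} [hT : Fact (0 < T)]

lemma ae_haarAddCircle : ae (haarAddCircle (T := T)) = ae (volume : Measure (AddCircle T)) := by
  rw [volume_eq_smul_haarAddCircle,
    Measure.ae_ennreal_smul_measure_eq (by simpa using hT.out)]

lemma fourierCoeff_comp_add_right (f : AddCircle T → ℂ) (a : AddCircle T) (n : ℤ) :
    fourierCoeff (fun t => f (t + a)) n = fourier n a * fourierCoeff f n := by
  have h := integral_add_right_eq_self (μ := haarAddCircle (T := T))
    (fun t => fourier (-n) (t - a) • f t) a
  simp only [add_sub_cancel_right] at h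
  rw [fourierCoeff, h, fourierCoeff, ← integral_const_mul]
  refine integral_congr_ae (ae_of_all _ fun t => ?_)
  have hta : -n • (t - a) = n • a + -n • t := by
    rw [smul_sub, neg_smul, neg_smul]
    abel
  simp only [fourier_apply, smul_eq_mul]
  rw [hta, toCircle_add, Circle.coe_mul, mul_assoc]

lemma fourierCoeff_neg_of_conj {f : AddCircle T → ℂ} (hf : ∀ᵐ t ∂haarAddCircle, conj (f t) = f t)
    (n : ℤ) : fourierCoeff f (-n) = conj (fourierCoeff f n) := by
  rw [fourierCoeff, fourierCoeff, ← integral_conj]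
  refine integral_congr_ae (hf.mono fun t ht => ?_)
  simp only [smul_eq_mul, map_mul, ht, fourier_neg, Complex.conj_conj]

lemma ae_eq_zero_of_fourierCoeff_eq_zero {f : AddCircle T → ℂ} (hf : MemLp f 2 haarAddCircle)
    (h : ∀ n, fourierCoeff f n = 0) : f =ᵐ[haarAddCircle] 0 := by
  have h0 : hf.toLp = 0 := by
    refine (hasSum_fourier_series_L2 hf.toLp).unique ?_
    simp [fourierCoeff_congr_ae hf.coeFn_toLp, h]
  exact hf.coeFn_toLp.symm.trans ((Lp.eq_zero_iff_ae_eq_zero).1 h0)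

lemma eq_zero_of_hasSum_fourier_zero {d : ℤ → ℂ}
    (h : HasSum (fun k => d k • (fourier k : C(AddCircle T, ℂ))) 0) (j : ℤ) : d j = 0 := by
  have h2 := (h.mapL (ContinuousMap.toLp (E := ℂ) 2 haarAddCircle ℂ)).mapL
    (innerSL ℂ (fourierLp (T := T) 2 j))
  have h3 : ∀ k, innerSL ℂ (fourierLp (T := T) 2 j)
      (ContinuousMap.toLp (E := ℂ) 2 haarAddCircle ℂ (d k • (fourier k : C(AddCircle T, ℂ)))) =
      if k = j then d j else 0 := by
    intro k
    rw [map_smul, map_smul, smul_eq_mul, innerSL_apply_apply]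
    have := orthonormal_iff_ite.1 (orthonormal_fourier (T := T)) j k
    rw [fourierLp] at this ⊢
    rw [fourierLp] at this
    rw [this]
    aesop
  simp only [h3, map_zero] at h2
  exact (hasSum_ite_eq j (d j)).unique h2

lemma memLp_haarAddCircle (F : Lp ℂ ⊤ (volume : Measure (AddCircle T))) (p : ENNReal) :
    MemLp F p haarAddCircle :=
  (Lp.memLp F).haarAddCircle.mono_exponent le_top

lemma integrable_haarAddCircle (F : Lp ℂ ⊤ (volume : Measure (AddCircle T))) :
    Integrable F haarAddCircle :=
  memLp_one_iff_integrable.1 (memLp_haarAddCircle F 1)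

lemma ae_norm_le_norm_Lp_top {α : Type*} [MeasurableSpace α] {μ : Measure α} (F : Lp ℂ ⊤ μ) :
    ∀ᵐ t ∂μ, ‖F t‖ ≤ ‖F‖ := by
  have h := ae_le_eLpNormEssSup (f := F) (μ := μ)
  rw [← eLpNorm_exponent_top] at h
  filter_upwards [h] with t ht
  rw [Lp.norm_def, ← toReal_enorm]
  exact ENNReal.toReal_mono (Lp.eLpNorm_ne_top F) ht

lemma norm_fourierCoeff_le (F : Lp ℂ ⊤ (volume : Measure (AddCircle T))) (n : ℤ) :
    ‖fourierCoeff F n‖ ≤ ‖F‖ := by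
  have h : ∀ᵐ t ∂(haarAddCircle (T := T)), ‖fourier (-n) t • F t‖ ≤ ‖F‖ := by
    rw [ae_haarAddCircle]
    filter_upwards [ae_norm_le_norm_Lp_top F] with t ht
    rwa [fourier_apply, norm_smul, Circle.norm_coe, one_mul]
  simpa [fourierCoeff] using norm_integral_le_of_norm_le_const h

lemma fourierCoeff_add_Lp (F G : Lp ℂ ⊤ (volume : Measure (AddCircle T))) (n : ℤ) :
    fourierCoeff (F + G : Lp ℂ ⊤ volume) n = fourierCoeff F n + fourierCoeff G n := by
  have h : ((F + G : Lp ℂ ⊤ volume) : AddCircle T → ℂ) =ᵐ[haarAddCircle] F + G := by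
    rw [EventuallyEq, ae_haarAddCircle]
    exact Lp.coeFn_add F G
  rw [fourierCoeff_congr_ae h,
    fourierCoeff.add (integrable_haarAddCircle F) (integrable_haarAddCircle G), Pi.add_apply]

lemma fourierCoeff_smul_Lp (c : ℂ) (F : Lp ℂ ⊤ (volume : Measure (AddCircle T))) (n : ℤ) :
    fourierCoeff (c • F : Lp ℂ ⊤ volume) n = c * fourierCoeff F n := by
  have h : ((c • F : Lp ℂ ⊤ volume) : AddCircle T → ℂ) =ᵐ[haarAddCircle] c • F := by
    rw [EventuallyEq, ae_haarAddCircle]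
    exact Lp.coeFn_smul c F
  rw [fourierCoeff_congr_ae h, fourierCoeff.const_smul, smul_eq_mul]

lemma summable_mul_fourierCoeff {a : ℤ → ℝ} (ha0 : ∀ k, 0 ≤ a k) (ha : Summable a)
    (F : Lp ℂ ⊤ (volume : Measure (AddCircle T))) :
    Summable fun k => ‖(a k : ℂ) * fourierCoeff F k‖ := by
  refine Summable.of_nonneg_of_le (fun _ => norm_nonneg _) (fun k => ?_) (ha.mul_right ‖F‖)
  rw [norm_mul, Complex.norm_of_nonneg (ha0 k)]
  gcongr
  · exact ha0 k
  · exact norm_fourierCoeff_le F k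

/-- The functional `F ↦ ∑ a k * fourierCoeff F k` on `L^∞` of the circle. -/
noncomputable def fourierFunctional (a : ℤ → ℝ) (ha0 : ∀ k, 0 ≤ a k) (ha : Summable a) :
    Lp ℂ ⊤ (volume : Measure (AddCircle T)) →ₗ[ℂ] ℂ where
  toFun F := ∑' k, (a k : ℂ) * fourierCoeff F k
  map_add' F G := by
    simp_rw [fourierCoeff_add_Lp, mul_add]
    exact (summable_mul_fourierCoeff ha0 ha F).of_norm.tsum_add
      (summable_mul_fourierCoeff ha0 ha G).of_norm
  map_smul' c F := by
    simp_rw [fourierCoeff_smul_Lp, mul_left_comm _ c, tsum_mul_left]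
    rfl

lemma norm_fourierFunctional_le {a : ℤ → ℝ} (ha0 : ∀ k, 0 ≤ a k) (ha : Summable a)
    (ha1 : ∑' k, a k ≤ 1) (F : Lp ℂ ⊤ (volume : Measure (AddCircle T))) :
    ‖fourierFunctional a ha0 ha F‖ ≤ ‖F‖ := by
  have h := summable_mul_fourierCoeff ha0 ha F
  calc ‖fourierFunctional a ha0 ha F‖ ≤ ∑' k, ‖(a k : ℂ) * fourierCoeff F k‖ :=
        norm_tsum_le_tsum_norm h
    _ ≤ ∑' k, a k * ‖F‖ := by
        refine h.tsum_le_tsum (fun k => ?_) (ha.mul_right _)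
        rw [norm_mul, Complex.norm_of_nonneg (ha0 k)]
        exact mul_le_mul_of_nonneg_left (norm_fourierCoeff_le F k) (ha0 k)
    _ = (∑' k, a k) * ‖F‖ := tsum_mul_right
    _ ≤ ‖F‖ := mul_le_of_le_one_left (norm_nonneg _) ha1

/-- A summable, strictly positive, even weight on `ℤ` of total mass at most one. -/
lemma exists_even_weight : ∃ a : ℤ → ℝ, (∀ k, 0 < a k) ∧ (∀ k, a (-k) = a k) ∧ Summable a ∧
    ∑' k, a k ≤ 1 := by
  obtain ⟨b, hb, c, hc, hc2⟩ := posSumOfEncodable (half_pos one_pos) ℤ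
  have hneg : HasSum (fun k => b (-k)) c := (Equiv.neg ℤ).hasSum_iff.2 hc
  have hsum := hc.add hneg
  refine ⟨fun k => b k + b (-k), fun k => add_pos (hb _) (hb _), fun k => ?_, hsum.summable, ?_⟩
  · simp only [neg_neg, add_comm]
  · rw [hsum.tsum_eq]
    linarith

/-- A real bounded function `G 0` vanishes if it has a backward orbit `G n` under `F ↦ -F(· - β)`
along which a weighted sum of the Fourier coefficients converges. -/
theorem ae_eq_zero_of_tendsto_fourierFunctional {a : ℤ → ℝ} (ha0 : ∀ k, 0 < a k)
    (heven : ∀ k, a (-k) = a k) (ha : Summable a) {β : AddCircle T}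
    (hβ : DenseRange fun n : ℤ => n • (2 • β))
    {G : ℕ → Lp ℂ ⊤ (volume : Measure (AddCircle T))}
    (hG : ∀ n k, fourierCoeff (G (n + 1)) k = -(fourier k β * fourierCoeff (G n) k))
    (hreal : ∀ᵐ t, conj (G 0 t) = G 0 t) {l : ℝ}
    (hl : Tendsto (fun n => (fourierFunctional a (fun k => (ha0 k).le) ha (G n)).re) atTop (𝓝 l)) :
    G 0 = 0 := by
  have hcoeff : ∀ n k, fourierCoeff (G n) k =
      (-1) ^ n * (fourier k (n • β) * fourierCoeff (G 0) k) := by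
    intro n k
    induction n with
    | zero => simp
    | succ n ih =>
      rw [hG, ih, succ_nsmul, fourier_apply, fourier_apply, fourier_apply, smul_add, toCircle_add,
        Circle.coe_mul]
      ring
  set d : ℤ → ℂ := fun k => a k * fourierCoeff (G 0) k with hd
  have hdsum : Summable fun k => d k • (fourier k : C(AddCircle T, ℂ)) := by
    refine Summable.of_norm ?_
    simp_rw [norm_smul, fourier_norm, mul_one]
    exact summable_mul_fourierCoeff (fun k => (ha0 k).le) ha (G 0)
  set S : C(AddCircle T, ℂ) := ∑' k, d k • fourier k with hS
  have hSy : ∀ y, HasSum (fun k => d k * fourier k y) (S y) := fun y =>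
    hdsum.hasSum.mapL (ContinuousMap.evalCLM ℂ y)
  have hreal' : ∀ᵐ t ∂haarAddCircle, conj (G 0 t) = G 0 t := by
    rwa [ae_haarAddCircle]
  have hSreal : ∀ y, conj (S y) = S y := by
    intro y
    have h1 : HasSum (fun k => conj (d k * fourier k y)) (conj (S y)) :=
      (hSy y).map (starRingEnd ℂ) Complex.continuous_conj
    have h2 := (Equiv.neg ℤ).hasSum_iff.2 (hSy y)
    refine h1.unique (h2.congr_fun ?_)
    intro k
    simp only [Function.comp_apply, Equiv.neg_apply, hd, heven, fourier_neg,
      fourierCoeff_neg_of_conj hreal', map_mul, Complex.conj_ofReal]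
  have hval : ∀ n, fourierFunctional a (fun k => (ha0 k).le) ha (G n) = (-1) ^ n * S (n • β) := by
    intro n
    change ∑' k, (a k : ℂ) * fourierCoeff (G n) k = _
    rw [← (hSy _).tsum_eq, ← tsum_mul_left]
    refine tsum_congr fun k => ?_
    rw [hcoeff, hd]
    ring
  have hSre : ∀ y, (S y).re = 0 := by
    refine eq_zero_of_tendsto_alternating (H := fun y => (S y).re) (by fun_prop) hβ (hl.congr ?_)
    intro n
    rw [hval, show ((-1 : ℂ) ^ n) = ((-1 : ℝ) ^ n : ℝ) by push_cast; rfl, Complex.re_ofReal_mul]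
  have hS0 : S = 0 := by
    ext y
    rw [← Complex.conj_eq_iff_re.1 (hSreal y), hSre]
    rfl
  have hd0 := eq_zero_of_hasSum_fourier_zero (hS0 ▸ hS ▸ hdsum.hasSum)
  have hc0 : ∀ k, fourierCoeff (G 0) k = 0 := fun k =>
    (mul_eq_zero.1 (hd0 k)).resolve_left (Complex.ofReal_ne_zero.2 (ha0 k).ne')
  have hae := ae_eq_zero_of_fourierCoeff_eq_zero (memLp_haarAddCircle (G 0) 2) hc0
  rw [EventuallyEq, ae_haarAddCircle] at hae
  exact (Lp.eq_zero_iff_ae_eq_zero).2 hae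

end FourierCoefficients

section Circle

open MeasureTheory Filter AddCircle
open scoped ComplexConjugate

section Rotation

variable {T : ℝ} [hT : Fact (0 < T)]

/-- Translation by `γ` on `L^∞` of the circle. -/
noncomputable def translateLp (γ : AddCircle T) :
    Lp ℂ ⊤ (volume : Measure (AddCircle T)) →ₗᵢ[ℂ] Lp ℂ ⊤ (volume : Measure (AddCircle T)) :=
  Lp.compMeasurePreservingₗᵢ ℂ (fun x => x + γ) (measurePreserving_add_right volume γ)

lemma coeFn_translateLp (γ : AddCircle T) (F : Lp ℂ ⊤ (volume : Measure (AddCircle T))) :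
    translateLp γ F =ᵐ[volume] fun x => F (x + γ) :=
  Lp.coeFn_compMeasurePreserving F (measurePreserving_add_right volume γ)

lemma translateLp_translateLp {γ δ : AddCircle T} (h : γ + δ = 0)
    (F : Lp ℂ ⊤ (volume : Measure (AddCircle T))) : translateLp γ (translateLp δ F) = F := by
  refine Lp.ext ?_
  have h1 := coeFn_translateLp γ (translateLp δ F)
  have h2 := (measurePreserving_add_right volume γ).quasiMeasurePreserving.ae_eq_comp
    (coeFn_translateLp δ F)
  filter_upwards [h1, h2] with x hx1 hx2
  rw [hx1]
  refine hx2.trans ?_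
  simp [add_assoc, h]

lemma fourierCoeff_translateLp (γ : AddCircle T) (F : Lp ℂ ⊤ (volume : Measure (AddCircle T)))
    (k : ℤ) : fourierCoeff (translateLp γ F) k = fourier k γ * fourierCoeff F k := by
  rw [← fourierCoeff_comp_add_right]
  refine congrFun (fourierCoeff_congr_ae ?_) k
  rw [EventuallyEq, ae_haarAddCircle]
  exact coeFn_translateLp γ F

end Rotation

lemma im_eq_zero_of_norm_add_int_mul_I_sq_le {z : ℂ} {C : ℝ}
    (h : ∀ n : ℤ, ‖z + n * Complex.I‖ ^ 2 ≤ C + n ^ 2) : z.im = 0 := by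
  have h' : ∀ n : ℤ, 2 * n * z.im ≤ C := by
    intro n
    have hn := h n
    rw [Complex.sq_norm, Complex.normSq_apply] at hn
    simp only [Complex.add_re, Complex.add_im, Complex.mul_re, Complex.mul_im, Complex.intCast_re,
      Complex.intCast_im, Complex.I_re, Complex.I_im] at hn
    nlinarith [sq_nonneg z.re, sq_nonneg z.im]
  by_contra hz
  obtain ⟨N, hN⟩ := Archimedean.arch (C + 1) (abs_pos.2 hz)
  rw [nsmul_eq_mul] at hN
  have hNz : 0 ≤ N * |z.im| := by positivity
  rcases abs_cases z.im with ⟨hz', -⟩ | ⟨hz', -⟩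
  · have := h' N
    rw [hz'] at hN hNz
    push_cast at this
    linarith
  · have := h' (-N)
    rw [hz'] at hN hNz
    push_cast at this
    linarith

variable {M : Type*} [TopologicalSpace M] [CompactSpace M] {T : ℝ} [hT : Fact (0 < T)]
  {e : C(M, ℂ) ≃ₗᵢ[ℂ] Lp ℂ ⊤ (volume : Measure (AddCircle T))}

lemma coe_map_one_of_multiplicative
    (he : ∀ f g : C(M, ℂ), (e (f * g) : AddCircle T →ₘ[volume] ℂ) = ↑(e f) * ↑(e g)) :
    (e 1 : AddCircle T →ₘ[volume] ℂ) = 1 := by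
  have h := he 1 (e.symm (Lp.const ⊤ volume (1 : ℂ)))
  rw [one_mul, e.apply_symm_apply] at h
  have h1 : ((Lp.const ⊤ (volume : Measure (AddCircle T)) (1 : ℂ) :
      Lp ℂ ⊤ (volume : Measure (AddCircle T))) : AddCircle T →ₘ[volume] ℂ) = 1 := rfl
  rw [h1, mul_one] at h
  exact h.symm

lemma ae_conj_eq_of_multiplicative
    (he : ∀ f g : C(M, ℂ), (e (f * g) : AddCircle T →ₘ[volume] ℂ) = ↑(e f) * ↑(e g))
    {u : C(M, ℂ)} (hu : ∀ x, (u x).im = 0) : ∀ᵐ t, conj (e u t) = e u t := by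
  have hone : (e 1 : AddCircle T → ℂ) =ᵐ[volume] 1 := by
    rw [show (e 1 : AddCircle T → ℂ) = (1 : AddCircle T →ₘ[volume] ℂ) by
      rw [← coe_map_one_of_multiplicative he]]
    exact AEEqFun.coeFn_one
  have hbound : ∀ n : ℤ, ‖u + (n * Complex.I : ℂ) • (1 : C(M, ℂ))‖ ^ 2 ≤ ‖u‖ ^ 2 + n ^ 2 := by
    intro n
    have hle : ‖u + (n * Complex.I : ℂ) • (1 : C(M, ℂ))‖ ≤ √(‖u‖ ^ 2 + n ^ 2) := by
      refine (ContinuousMap.norm_le _ (Real.sqrt_nonneg _)).2 fun x => Real.le_sqrt_of_sq_le ?_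
      have hx := u.norm_coe_le_norm x
      have hx2 : ‖u x‖ ^ 2 ≤ ‖u‖ ^ 2 := by gcongr
      rw [Complex.sq_norm, Complex.normSq_apply] at hx2 ⊢
      simp only [ContinuousMap.add_apply, ContinuousMap.smul_apply, ContinuousMap.one_apply,
        smul_eq_mul, mul_one, Complex.add_re, Complex.add_im, Complex.mul_re, Complex.mul_im,
        Complex.intCast_re, Complex.intCast_im, Complex.I_re, Complex.I_im, hu] at hx2 ⊢
      nlinarith
    calc _ ≤ √(‖u‖ ^ 2 + n ^ 2) ^ 2 := by gcongr
      _ = _ := Real.sq_sqrt (by positivity)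
  have hae : ∀ n : ℤ, ∀ᵐ t, ‖e u t + n * Complex.I‖ ^ 2 ≤ ‖u‖ ^ 2 + n ^ 2 := by
    intro n
    have h1 := ae_norm_le_norm_Lp_top (e (u + (n * Complex.I : ℂ) • (1 : C(M, ℂ))))
    rw [e.norm_map, map_add, map_smul] at h1
    filter_upwards [h1, Lp.coeFn_add (e u) ((n * Complex.I : ℂ) • e 1),
      Lp.coeFn_smul (n * Complex.I : ℂ) (e 1), hone] with t ht1 ht2 ht3 ht4
    rw [ht2, Pi.add_apply, ht3, Pi.smul_apply, ht4, Pi.one_apply, smul_eq_mul, mul_one] at ht1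
    exact (by gcongr : _ ≤ _).trans (hbound n)
  filter_upwards [ae_all_iff.2 hae] with t ht
  exact Complex.conj_eq_iff_im.2 (im_eq_zero_of_norm_add_int_mul_I_sq_le ht)

/-- The endomorphism of the algebra `C(M, ℂ)` corresponding to a translation of the circle. -/
noncomputable def translateAlgHom
    (he : ∀ f g : C(M, ℂ), (e (f * g) : AddCircle T →ₘ[volume] ℂ) = ↑(e f) * ↑(e g))
    (γ : AddCircle T) : C(M, ℂ) →ₐ[ℂ] C(M, ℂ) :=
  AlgHom.ofLinearMap
    (e.symm.toLinearEquiv.toLinearMap ∘ₗ (translateLp γ).toLinearMap ∘ₗ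
      e.toLinearEquiv.toLinearMap)
    (by
      refine e.symm_apply_eq.2 (Subtype.ext ?_)
      change AEEqFun.compMeasurePreserving (e 1 : AddCircle T →ₘ[volume] ℂ) _
        (measurePreserving_add_right volume γ) = _
      rw [coe_map_one_of_multiplicative he]
      rfl)
    (by
      intro f g
      refine e.symm_apply_eq.2 (Subtype.ext ?_)
      rw [he]
      change AEEqFun.compMeasurePreserving (e (f * g) : AddCircle T →ₘ[volume] ℂ) _
        (measurePreserving_add_right volume γ) = (e (e.symm (translateLp γ (e f))) : _ →ₘ[_] ℂ) *
          (e (e.symm (translateLp γ (e g))) : _ →ₘ[_] ℂ)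
      rw [he, e.apply_symm_apply, e.apply_symm_apply]
      change _ = AEEqFun.compMeasurePreserving (e f : AddCircle T →ₘ[volume] ℂ) _
        (measurePreserving_add_right volume γ) * AEEqFun.compMeasurePreserving
          (e g : AddCircle T →ₘ[volume] ℂ) _ (measurePreserving_add_right volume γ)
      induction (e f : AddCircle T →ₘ[volume] ℂ) using AEEqFun.induction_on
      induction (e g : AddCircle T →ₘ[volume] ℂ) using AEEqFun.induction_on
      rfl)

lemma map_translateAlgHom
    (he : ∀ f g : C(M, ℂ), (e (f * g) : AddCircle T →ₘ[volume] ℂ) = ↑(e f) * ↑(e g))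
    (γ : AddCircle T) (f : C(M, ℂ)) : e (translateAlgHom he γ f) = translateLp γ (e f) :=
  e.apply_symm_apply _

lemma translateAlgHom_translateAlgHom
    (he : ∀ f g : C(M, ℂ), (e (f * g) : AddCircle T →ₘ[volume] ℂ) = ↑(e f) * ↑(e g))
    {γ δ : AddCircle T} (h : γ + δ = 0) (f : C(M, ℂ)) :
    translateAlgHom he γ (translateAlgHom he δ f) = f :=
  e.injective (by rw [map_translateAlgHom, map_translateAlgHom, translateLp_translateLp h])

/-- Translations of the circle are implemented on `M` by homeomorphisms. -/
theorem exists_homeomorph_translateLp [T2Space M]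
    (he : ∀ f g : C(M, ℂ), (e (f * g) : AddCircle T →ₘ[volume] ℂ) = ↑(e f) * ↑(e g))
    (γ : AddCircle T) :
    ∃ φ : M ≃ₜ M, ∀ f : C(M, ℂ), e (f.comp (φ : C(M, M))) = translateLp γ (e f) := by
  obtain ⟨φ, hφ⟩ := exists_homeomorph_of_algHom (translateAlgHom he γ) (translateAlgHom he (-γ))
    (translateAlgHom_translateAlgHom he (add_neg_cancel γ))
    (translateAlgHom_translateAlgHom he (neg_add_cancel γ))
  exact ⟨φ, fun f => by rw [← hφ, map_translateAlgHom]⟩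

end Circle

section RealPart

variable {𝕂 M : Type*} [RCLike 𝕂] [TopologicalSpace M]

/-- The real part of a `𝕂`-valued function, as a complex-valued function. -/
noncomputable def reToComplex : C(M, 𝕂) →ₗ[ℝ] C(M, ℂ) where
  toFun g := ⟨fun x => ((RCLike.re (g x) : ℝ) : ℂ), by fun_prop⟩
  map_add' f g := by ext x; simp
  map_smul' a f := by ext x; simp [RCLike.smul_re]

lemma reToComplex_apply (g : C(M, 𝕂)) (x : M) :
    reToComplex g x = ((RCLike.re (g x) : ℝ) : ℂ) := rfl

lemma norm_reToComplex_le [CompactSpace M] (g : C(M, 𝕂)) : ‖reToComplex g‖ ≤ ‖g‖ := by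
  refine (ContinuousMap.norm_le _ (norm_nonneg _)).2 fun x => ?_
  rw [reToComplex_apply, Complex.norm_real]
  exact (RCLike.norm_re_le_norm _).trans (g.norm_coe_le_norm x)

lemma eq_zero_of_reToComplex {g : C(M, 𝕂)} (h : reToComplex g = 0)
    (hI : reToComplex ((RCLike.I : 𝕂) • g) = 0) : g = 0 := by
  ext x
  have h1 := DFunLike.congr_fun h x
  have h2 := DFunLike.congr_fun hI x
  rw [reToComplex_apply, ContinuousMap.zero_apply, Complex.ofReal_eq_zero] at h1 h2
  rw [ContinuousMap.smul_apply, smul_eq_mul, RCLike.I_mul_re, neg_eq_zero] at h2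
  exact RCLike.ext (by simpa using h1) (by simpa using h2)

/-- The isometry `g ↦ -(g ∘ φ)` of `C(M, 𝕂)` induced by a homeomorphism `φ`. -/
noncomputable def negCompHomeomorph [CompactSpace M] (φ : M ≃ₜ M) :
    C(M, 𝕂) ≃ₗᵢ[𝕂] C(M, 𝕂) where
  toFun g := -g.comp (φ : C(M, M))
  invFun g := -g.comp (φ.symm : C(M, M))
  map_add' f g := by ext x; simp [add_comm]
  map_smul' a g := by ext x; simp
  left_inv g := by ext x; simp
  right_inv g := by ext x; simp
  norm_map' g := by
    refine le_antisymm ((ContinuousMap.norm_le _ (norm_nonneg _)).2 fun x => ?_)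
      ((ContinuousMap.norm_le _ (norm_nonneg _)).2 fun x => ?_)
    · simpa using g.norm_coe_le_norm (φ x)
    · simpa using (-g.comp (φ : C(M, M))).norm_coe_le_norm (φ.symm x)

lemma negCompHomeomorph_apply [CompactSpace M] (φ : M ≃ₜ M) (g : C(M, 𝕂)) :
    negCompHomeomorph φ g = -g.comp (φ : C(M, M)) := rfl

end RealPart

/-- If `C(M;ℂ)` is isometrically algebra-isomorphic to `L^∞(𝕋)` then
`C(M ⊕ OnePoint ℕ; 𝕂)` admits an isometric shift (`𝕂 = ℝ` or `ℂ`). -/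
theorem stmt0 (𝕂 : Type) [RCLike 𝕂] (M : Type) [TopologicalSpace M] [CompactSpace M]
    [T2Space M] (hM : IsCMIsoLinftyCircle M) :
    ∃ T : C(M ⊕ OnePoint ℕ, 𝕂) →L[𝕂] C(M ⊕ OnePoint ℕ, 𝕂), IsIsometricShift T := by
  obtain ⟨e, he⟩ := hM
  obtain ⟨β, hβ⟩ := exists_denseRange_zsmul_two_nsmul
  obtain ⟨a, ha0, heven, ha, ha1⟩ := exists_even_weight
  obtain ⟨φ, hφ⟩ := exists_homeomorph_translateLp he (-β)
  let P := fourierFunctional (T := 2 * Real.pi) a (fun k => (ha0 k).le) ha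
  let L : Module.Dual ℝ C(M, 𝕂) := Complex.reLm ∘ₗ P.restrictScalars ℝ ∘ₗ
    (e.toLinearEquiv.toLinearMap.restrictScalars ℝ) ∘ₗ reToComplex
  have hL : ∀ g, |L g| ≤ normSeminorm 𝕂 C(M, 𝕂) g := fun g => calc
    |L g| ≤ ‖P (e (reToComplex g))‖ := Complex.abs_re_le_norm _
    _ ≤ ‖e (reToComplex g)‖ := norm_fourierFunctional_le _ ha ha1 _
    _ ≤ ‖g‖ := by rw [e.norm_map]; exact norm_reToComplex_le g
  let Λ : C(M, 𝕂) →ₗ[𝕂] 𝕂 := L.extendRCLike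
  have hre : ∀ g : ℕ → C(M, 𝕂), (∀ n, negCompHomeomorph φ (g (n + 1)) = g n) →
      ∀ l, Filter.Tendsto (fun n => Λ (g n)) Filter.atTop (𝓝 l) → reToComplex (g 0) = 0 := by
    intro g hg l hl
    have hlim : Filter.Tendsto (fun n => L (g n)) Filter.atTop (𝓝 (RCLike.re l)) := by
      refine ((RCLike.continuous_re.tendsto l).comp hl).congr fun n => ?_
      exact L.re_extendRCLike_apply (g n)
    refine e.map_eq_zero_iff.1 ?_
    refine ae_eq_zero_of_tendsto_fourierFunctional (G := fun n => e (reToComplex (g n)))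
      ha0 heven ha hβ ?_ ?_ hlim
    · intro n k
      have h1 : reToComplex (g n) = -(reToComplex (g (n + 1))).comp (φ : C(M, M)) := by
        rw [← hg n]
        ext x
        simp [reToComplex_apply, negCompHomeomorph_apply]
      have h2 : e (reToComplex (g n)) = (-1 : ℂ) •
          translateLp (-β) (e (reToComplex (g (n + 1)))) := by
        rw [h1, map_neg, hφ, neg_one_smul]
      rw [h2, fourierCoeff_smul_Lp, fourierCoeff_translateLp]
      have h3 : fourier k β * fourier k (-β) = 1 := by
        rw [fourier_apply, fourier_apply, ← Circle.coe_mul, ← AddCircle.toCircle_add, ← smul_add,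
          add_neg_cancel, smul_zero, AddCircle.toCircle_zero, Circle.coe_one]
      linear_combination (-fourierCoeff (e (reToComplex (g (n + 1)))) k) * h3
    · exact ae_conj_eq_of_multiplicative he fun x => Complex.ofReal_im _
  refine exists_isIsometricShift (negCompHomeomorph φ) Λ
    (Module.Dual.norm_extendRCLike_le_seminorm L (p := normSeminorm 𝕂 C(M, 𝕂)) hL)
    fun g hg l hl => ?_
  refine eq_zero_of_reToComplex (hre g hg l hl) ?_
  refine hre (fun n => (RCLike.I : 𝕂) • g n) (fun n => by rw [map_smul, hg]) (RCLike.I * l) ?_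
  simpa only [map_smul, smul_eq_mul] using hl.const_mul RCLike.I
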